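/- arXiv:2404.08074 — 2 statements merged into one kernel-verified Lean document; each statement's English description precedes it below -/
import Mathlib

section
/- Fix F > 0. Let β ∈ (0,1) and κ ∈ ℝ satisfy cos(πβ) > κ sin(πβ), set γ := −4 sin(πβ)/(cos(πβ) − κ sin(πβ)), a(ξ) := 1 − (γ/2)·sin(πβ)/(cosh(πξ) + cos(πβ)), and W_ζ(ζ) := 1 + (γ/(4i))·[coth(π(ζ−iβ)/2) − coth(π(ζ+iβ)/2)]. Let f be holomorphic on the strip D = {−1 < Im ζ < 1} with f(−ζ) = −f(ζ) and f(conj ζ) = conj(f(ζ)), such that f' and f'' extend continuously to cl(D), f' is nonvanishing on cl(D), and f'(ζ) → 1 as |Re ζ| → ∞ uniformly; write w := Im f − Im ζ, and assume w and its derivatives up to second order tend to 0 as |Re ζ| → ∞ uniformly. Assume f''(iβ)/f'(iβ) = πiκ and the Bernoulli condition (1/2)·a(ξ)²/(w_ξ(ξ,1)² + (1+w_η(ξ,1))²) + w(ξ,1)/F² = 1/2 for all ξ ∈ ℝ. Define V := −Im(W_ζ/f'). If V ≤ 0 on {(ξ,η) : ξ > 0, 0 < η ≤ 1} \ {iβ},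 then V < 0 there. -/
open Set

/-- Complex hyperbolic cotangent. -/
noncomputable def cCoth (z : ℂ) : ℂ := Complex.cosh z / Complex.sinh z

/-- The derivative `W_ζ` of the complex relative velocity potential for a point vortex of
strength `γ` at `iβ` and a mirror vortex of strength `-γ` at `-iβ` in the strip. -/
noncomputable def Wzeta (γ β : ℝ) (z : ℂ) : ℂ :=
  1 + (γ : ℂ) / (4 * Complex.I) *
    (cCoth ((Real.pi : ℂ) / 2 * (z - Complex.I * β)) -
      cCoth ((Real.pi : ℂ) / 2 * (z + Complex.I * β)))

/-- The circulation `γ(κ,β)` determined by the Helmholtz–Kirchhoff condition. -/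
noncomputable def gammaPV (κ β : ℝ) : ℝ :=
  -4 * Real.sin (Real.pi * β) / (Real.cos (Real.pi * β) - κ * Real.sin (Real.pi * β))

/-- The trace `a(ξ;κ,β)` on the line `{Im ζ = 1}` of the derivative of the complex relative
velocity potential. -/
noncomputable def avort (κ β ξ : ℝ) : ℝ :=
  1 - gammaPV κ β / 2 * Real.sin (Real.pi * β) / (Real.cosh (Real.pi * ξ) + Real.cos (Real.pi * β))

/-- The open strip `D = {ζ : -1 < Im ζ < 1}`. -/
def Dstrip : Set ℂ := {z : ℂ | z.im ∈ Ioo (-1 : ℝ) 1}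

/-- The closed strip `cl(D) = {ζ : -1 ≤ Im ζ ≤ 1}`. -/
def clDstrip : Set ℂ := {z : ℂ | z.im ∈ Icc (-1 : ℝ) 1}

/-- Partial derivative of a function on `ℂ` in the horizontal direction. -/
noncomputable def pdxC (u : ℂ → ℝ) (z : ℂ) : ℝ :=
  deriv (fun x : ℝ => u ((x : ℂ) + (z.im : ℂ) * Complex.I)) z.re

/-- Partial derivative of a function on `ℂ` in the vertical direction. -/
noncomputable def pdyC (u : ℂ → ℝ) (z : ℂ) : ℝ :=
  deriv (fun y : ℝ => u ((z.re : ℂ) + (y : ℂ) * Complex.I)) z.im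

open Topology Filter Metric in
theorem aux_hopf (h : ℂ → ℂ) (c : ℂ) (r : ℝ) (hd : DifferentiableOn ℂ h (ball c r))
    (hpos : ∀ z ∈ ball c r, 0 < (h z).im) (z : ℂ) (hz : z ∈ ball c r) :
    (h c).im * (1 - (dist z c / r) ^ 2) ≤ 4 * (h z).im := by
  have hr : 0 < r := nonempty_ball.mp ⟨_, hz⟩
  have hc : c ∈ ball c r := mem_ball_self hr
  have hq := hpos c hc
  have hp := hpos z hz
  have hne : ∀ x ∈ ball c r, h x - (starRingEnd ℂ) (h c) ≠ 0 := by
    intro x hx h0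
    have := congrArg Complex.im h0
    simp at this
    have := hpos x hx
    linarith
  have key : ∀ x : ℂ, ‖h x - (starRingEnd ℂ) (h c)‖ ^ 2 - ‖h x - h c‖ ^ 2
      = 4 * (h x).im * (h c).im := by
    intro x
    rw [Complex.sq_norm, Complex.sq_norm, Complex.normSq_apply, Complex.normSq_apply]
    simp
    ring
  set φ : ℂ → ℂ := fun x => (h x - h c) / (h x - (starRingEnd ℂ) (h c)) with hφ
  have hφc : φ c = 0 := by simp [hφ]
  have hφd : DifferentiableOn ℂ φ (ball c r) :=
    (hd.sub_const _).div (hd.sub_const _) hne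
  have hmaps : MapsTo φ (ball c r) (closedBall (φ c) 1) := by
    intro x hx
    rw [hφc, mem_closedBall_zero_iff, hφ]
    simp only [norm_div]
    apply div_le_one_of_le₀ _ (norm_nonneg _)
    have h1 := key x
    have h2 : 0 < 4 * (h x).im * (h c).im := by have := hpos x hx; positivity
    nlinarith [norm_nonneg (h x - h c), norm_nonneg (h x - (starRingEnd ℂ) (h c))]
  have hs := Complex.dist_le_div_mul_dist_of_mapsTo_ball hφd hmaps hz
  rw [hφc, dist_zero_right, one_div_mul_eq_div] at hs
  simp only [hφ, norm_div] at hs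
  have hN : 0 < ‖h z - (starRingEnd ℂ) (h c)‖ := norm_pos_iff.mpr (hne z hz)
  rw [div_le_iff₀ hN] at hs
  have hNq : (h c).im ≤ ‖h z - (starRingEnd ℂ) (h c)‖ := by
    have := Complex.abs_im_le_norm (h z - (starRingEnd ℂ) (h c))
    simp at this
    have := le_abs_self ((h z).im + (h c).im)
    linarith
  have hs0 : 0 ≤ dist z c / r := by positivity
  have hs1 : dist z c / r < 1 := by rw [div_lt_one hr]; exact hz
  set s := dist z c / r
  set N := ‖h z - (starRingEnd ℂ) (h c)‖
  have h1 := key z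
  have h2 : ‖h z - h c‖ ^ 2 ≤ s ^ 2 * N ^ 2 := by
    rw [← mul_pow]; exact pow_le_pow_left₀ (norm_nonneg _) hs 2
  have h3 : (1 - s ^ 2) * N ^ 2 ≤ 4 * (h z).im * (h c).im := by linarith
  have h4 : (1 - s ^ 2) * (h c).im ^ 2 ≤ (1 - s ^ 2) * N ^ 2 := by
    apply mul_le_mul_of_nonneg_left _ (by nlinarith)
    exact pow_le_pow_left₀ hq.le hNq 2
  have h5 : (h c).im * ((h c).im * (1 - s ^ 2)) ≤ (h c).im * (4 * (h z).im) := by linarith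
  exact le_of_mul_le_mul_left h5 hq

theorem aux_D_open : IsOpen Dstrip := isOpen_Ioo.preimage Complex.continuous_im

theorem aux_D_sub : Dstrip ⊆ clDstrip := fun _ hz => Ioo_subset_Icc_self hz

theorem aux_D_closure : closure Dstrip = clDstrip := by
  have h1 : Dstrip = (univ : Set ℝ) ×ℂ Ioo (-1 : ℝ) 1 := by
    ext z; simp [Dstrip, Complex.mem_reProdIm]
  have h2 : clDstrip = (univ : Set ℝ) ×ℂ Icc (-1 : ℝ) 1 := by
    ext z; simp [clDstrip, Complex.mem_reProdIm]
  rw [h1, h2, Complex.closure_reProdIm, closure_univ, closure_Ioo (by norm_num)]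

theorem aux_D_convex : Convex ℝ Dstrip :=
  (convex_Ioo (-1 : ℝ) 1).linear_preimage Complex.imLm

theorem aux_ext {E' : Type*} [NormedAddCommGroup E'] [NormedSpace ℝ E'] (u : ℂ → E')
    (L : ℂ → ℂ →L[ℝ] E') (hu : ContinuousOn u clDstrip) (hL : ContinuousOn L clDstrip)
    (h : ∀ z ∈ Dstrip, HasFDerivAt u (L z) z) (z : ℂ) (hz : z ∈ clDstrip) :
    HasFDerivWithinAt u (L z) clDstrip z := by
  rw [← aux_D_closure]
  apply hasFDerivWithinAt_closure_of_tendsto_fderiv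
    (fun z hz => (h z hz).differentiableAt.differentiableWithinAt) aux_D_convex aux_D_open
  · intro y hy
    rw [aux_D_closure] at hy
    exact (hu y hy).mono aux_D_sub
  · have := ((hL z hz).mono aux_D_sub).tendsto
    refine this.congr' ?_
    filter_upwards [self_mem_nhdsWithin] with y hy
    exact (h y hy).fderiv.symm

theorem aux_sinh_ne (z : ℂ) (hz : z.re ≠ 0) : Complex.sinh z ≠ 0 := by
  intro h
  rw [Complex.sinh, div_eq_zero_iff] at h
  rcases h with h | h
  · have h1 : Complex.exp z = Complex.exp (-z) := sub_eq_zero.mp h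
    have h2 := congrArg norm h1
    rw [Complex.norm_exp, Complex.norm_exp] at h2
    have := Real.exp_injective h2
    simp at this
    apply hz; linarith
  · norm_num at h

theorem aux_re1 (β : ℝ) (z : ℂ) : ((Real.pi : ℂ) / 2 * (z - Complex.I * β)).re
    = Real.pi / 2 * z.re := by
  have : ((Real.pi : ℂ) / 2) = ((Real.pi / 2 : ℝ) : ℂ) := by push_cast; rfl
  rw [this, Complex.re_ofReal_mul]; simp

theorem aux_re2 (β : ℝ) (z : ℂ) : ((Real.pi : ℂ) / 2 * (z + Complex.I * β)).re
    = Real.pi / 2 * z.re := by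
  have : ((Real.pi : ℂ) / 2) = ((Real.pi / 2 : ℝ) : ℂ) := by push_cast; rfl
  rw [this, Complex.re_ofReal_mul]; simp

theorem aux_W_diff (γ β : ℝ) (z : ℂ) (hz : 0 < z.re) : DifferentiableAt ℂ (Wzeta γ β) z := by
  have h1 : Complex.sinh ((Real.pi : ℂ) / 2 * (z - Complex.I * β)) ≠ 0 :=
    aux_sinh_ne _ (by rw [aux_re1]; have := Real.pi_pos; positivity)
  have h2 : Complex.sinh ((Real.pi : ℂ) / 2 * (z + Complex.I * β)) ≠ 0 :=
    aux_sinh_ne _ (by rw [aux_re2]; have := Real.pi_pos; positivity)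
  unfold Wzeta cCoth
  refine DifferentiableAt.add (by fun_prop) (DifferentiableAt.mul (by fun_prop)
    (DifferentiableAt.sub (DifferentiableAt.div (by fun_prop) (by fun_prop) h1)
      (DifferentiableAt.div (by fun_prop) (by fun_prop) h2)))

theorem aux_W_surf (κ β ξ : ℝ) (hξ : 0 < ξ) :
    Wzeta (gammaPV κ β) β ((ξ : ℂ) + Complex.I) = (avort κ β ξ : ℂ) := by
  set z : ℂ := (ξ : ℂ) + Complex.I with hzdef
  have hz : 0 < z.re := by simp [hzdef, hξ]
  have h1 : Complex.sinh ((Real.pi : ℂ) / 2 * (z - Complex.I * β)) ≠ 0 :=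
    aux_sinh_ne _ (by rw [aux_re1]; have := Real.pi_pos; positivity)
  have h2 : Complex.sinh ((Real.pi : ℂ) / 2 * (z + Complex.I * β)) ≠ 0 :=
    aux_sinh_ne _ (by rw [aux_re2]; have := Real.pi_pos; positivity)
  unfold Wzeta cCoth avort
  set A := (Real.pi : ℂ) / 2 * (z - Complex.I * β) with hA
  set B := (Real.pi : ℂ) / 2 * (z + Complex.I * β) with hB
  have hBA : Complex.sinh (B - A) = Complex.sin (Real.pi * β) * Complex.I := by
    rw [← Complex.sinh_mul_I]; congr 1; rw [hA, hB]; ring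
  have hBA' : Complex.cosh (B - A) = Complex.cos (Real.pi * β) := by
    rw [← Complex.cosh_mul_I]; congr 1; rw [hA, hB]; ring
  have hAB : Complex.cosh (B + A) = - Complex.cosh (Real.pi * ξ) := by
    have : B + A = Real.pi * ξ + Real.pi * Complex.I := by rw [hA, hB, hzdef]; ring
    rw [this, Complex.cosh_add, Complex.cosh_mul_I, Complex.sinh_mul_I]; simp
  rw [Complex.sinh_sub] at hBA
  have hprod : 2 * (Complex.sinh A * Complex.sinh B)
      = -(Complex.cosh (Real.pi * ξ) + Complex.cos (Real.pi * β)) := by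
    rw [Complex.cosh_sub] at hBA'
    rw [Complex.cosh_add] at hAB
    linear_combination hAB - hBA'
  have hne : Complex.cosh (Real.pi * ξ) + Complex.cos (Real.pi * β) ≠ 0 := by
    intro h0
    rw [h0] at hprod
    simp [h1, h2] at hprod
  push_cast
  have hI : Complex.I ≠ 0 := Complex.I_ne_zero
  have e : Complex.cosh A / Complex.sinh A - Complex.cosh B / Complex.sinh B
      = -2 * (Complex.sin (Real.pi * β) * Complex.I) /
        (Complex.cosh (Real.pi * ξ) + Complex.cos (Real.pi * β)) := by
    rw [div_sub_div _ _ h1 h2, div_eq_div_iff (mul_ne_zero h1 h2) hne]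
    linear_combination (Complex.cosh (Real.pi * ξ) + Complex.cos (Real.pi * β)) * hBA
      + (Complex.sin (Real.pi * β) * Complex.I) * hprod
  rw [e]
  field_simp
  ring

theorem aux_gamma_neg (κ β : ℝ) (hβ : β ∈ Ioo (0 : ℝ) 1)
    (hκ : κ * Real.sin (Real.pi * β) < Real.cos (Real.pi * β)) :
    0 < Real.sin (Real.pi * β) ∧ gammaPV κ β < 0 := by
  have hs : 0 < Real.sin (Real.pi * β) := by
    apply Real.sin_pos_of_pos_of_lt_pi
    · exact mul_pos Real.pi_pos hβ.1
    · nlinarith [Real.pi_pos, hβ.2]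
  refine ⟨hs, ?_⟩
  unfold gammaPV
  apply div_neg_of_neg_of_pos <;> linarith

theorem aux_a_pos (κ β ξ : ℝ) (hβ : β ∈ Ioo (0 : ℝ) 1)
    (hκ : κ * Real.sin (Real.pi * β) < Real.cos (Real.pi * β)) : 0 < avort κ β ξ := by
  obtain ⟨hs, hg⟩ := aux_gamma_neg κ β hβ hκ
  have h1 : 0 ≤ Real.cosh (Real.pi * ξ) + Real.cos (Real.pi * β) := by
    linarith [Real.one_le_cosh (Real.pi * ξ), Real.neg_one_le_cos (Real.pi * β)]
  unfold avort
  have : gammaPV κ β / 2 * Real.sin (Real.pi * β) /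
      (Real.cosh (Real.pi * ξ) + Real.cos (Real.pi * β)) ≤ 0 := by
    apply div_nonpos_of_nonpos_of_nonneg _ h1
    nlinarith
  linarith

/-- The open quarter strip. -/
def auxQ : Set ℂ := Ioi (0 : ℝ) ×ℂ Ioo (0 : ℝ) 1

theorem auxQ_open : IsOpen auxQ := isOpen_Ioi.reProdIm isOpen_Ioo

theorem auxQ_preconn : IsPreconnected auxQ :=
  Convex.isPreconnected <|
    ((convex_Ioi (0 : ℝ)).linear_preimage Complex.reLm).inter
    ((convex_Ioo (0 : ℝ) 1).linear_preimage Complex.imLm)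

open Topology Filter in
theorem aux_nonconst (γ β : ℝ) (hγ : γ ≠ 0) (hβ : β ∈ Ioo (0 : ℝ) 1) (g : ℂ → ℂ) (c : ℂ)
    (hs : 0 < Real.sin (Real.pi * β))
    (hgc : ContinuousOn g clDstrip) (h : ∀ z ∈ auxQ, Wzeta γ β z = c * g z) : False := by
  set p : ℂ := Complex.I * β with hp
  have hpcl : p ∈ closure auxQ := by
    rw [auxQ, Complex.closure_reProdIm, Complex.mem_reProdIm, closure_Ioo (by norm_num), closure_Ioi]
    simp [hp, hβ.1.le, hβ.2.le]
  have hsub : auxQ ⊆ clDstrip := fun z hz => ⟨by have : 0 < z.im := hz.2.1; linarith, hz.2.2.le⟩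
  have hpD : p ∈ clDstrip := ⟨by simp [hp]; linarith [hβ.1], by simp [hp, hβ.2.le]⟩
  have : (𝓝[auxQ] p).NeBot := mem_closure_iff_nhdsWithin_neBot.mp hpcl
  have hg : Tendsto g (𝓝[auxQ] p) (𝓝 (g p)) := (hgc p hpD).mono hsub
  let S : ℂ → ℂ := fun z => Complex.sinh ((Real.pi : ℂ) / 2 * (z - Complex.I * β))
  let C : ℂ → ℂ := fun z => Complex.cosh ((Real.pi : ℂ) / 2 * (z - Complex.I * β))
  have hS : Tendsto S (𝓝[auxQ] p) (𝓝 0) := by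
    have h1 : Continuous S := by fun_prop
    have h2 : S p = 0 := by simp [S, hp]
    rw [← h2]; exact h1.continuousAt.continuousWithinAt
  have hC : Tendsto C (𝓝[auxQ] p) (𝓝 1) := by
    have h1 : Continuous C := by fun_prop
    have h2 : C p = 1 := by simp [C, hp]
    rw [← h2]; exact h1.continuousAt.continuousWithinAt
  have hB : ContinuousAt (fun z => cCoth ((Real.pi : ℂ) / 2 * (z + Complex.I * β))) p := by
    unfold cCoth
    refine ContinuousAt.div (by fun_prop) (by fun_prop) ?_
    have : (Real.pi : ℂ) / 2 * (p + Complex.I * β) = ((Real.pi * β : ℝ) : ℂ) * Complex.I := by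
      rw [hp]; push_cast; ring
    rw [this, Complex.sinh_mul_I, ← Complex.ofReal_sin]
    exact mul_ne_zero (by exact_mod_cast hs.ne') Complex.I_ne_zero
  have hB' := hB.continuousWithinAt (s := auxQ).tendsto
  have l1 : Tendsto (fun z => Wzeta γ β z * S z) (𝓝[auxQ] p) (𝓝 (c * g p * 0)) := by
    refine ((hg.const_mul c).mul hS).congr' ?_
    filter_upwards [self_mem_nhdsWithin] with z hz
    rw [h z hz]
  have l2 : Tendsto (fun z => Wzeta γ β z * S z) (𝓝[auxQ] p)
      (𝓝 (0 + (γ : ℂ) / (4 * Complex.I) *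
        (1 - cCoth ((Real.pi : ℂ) / 2 * (p + Complex.I * β)) * 0))) := by
    refine (hS.add ((hC.sub (hB'.mul hS)).const_mul ((γ : ℂ) / (4 * Complex.I)))).congr' ?_
    filter_upwards [self_mem_nhdsWithin] with z hz
    have hz0 : 0 < z.re := hz.1
    have h1 : S z ≠ 0 :=
      aux_sinh_ne _ (by rw [aux_re1]; have := Real.pi_pos; positivity)
    have h3 : cCoth ((Real.pi : ℂ) / 2 * (z - Complex.I * β)) = C z / S z := rfl
    have h4 : C z / S z * S z = C z := div_mul_cancel₀ _ h1
    rw [Wzeta, h3]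
    linear_combination -(γ : ℂ) / (4 * Complex.I) * h4
  have := tendsto_nhds_unique l1 l2
  simp only [mul_zero, zero_add, sub_zero, mul_one] at this
  have h0 : (γ : ℂ) / (4 * Complex.I) ≠ 0 :=
    div_ne_zero (by exact_mod_cast hγ) (mul_ne_zero (by norm_num) Complex.I_ne_zero)
  exact h0 this.symm

theorem statement12 (F : ℝ) (hF0 : 0 < F) (β κ : ℝ) (hβ : β ∈ Ioo (0 : ℝ) 1)
    (hκ : κ * Real.sin (Real.pi * β) < Real.cos (Real.pi * β))
    (f g g2 : ℂ → ℂ) (w wx wy : ℂ → ℝ)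
    (hf : DifferentiableOn ℂ f Dstrip)
    (hodd : ∀ z ∈ Dstrip, f (-z) = -f z)
    (hconj : ∀ z ∈ Dstrip, f ((starRingEnd ℂ) z) = (starRingEnd ℂ) (f z))
    -- `g` and `g2` are the continuous extensions of `f'` and `f''` to the closed strip
    (hgc : ContinuousOn g clDstrip)
    (hge : ∀ z ∈ Dstrip, g z = deriv f z)
    (hg2c : ContinuousOn g2 clDstrip)
    (hg2e : ∀ z ∈ Dstrip, g2 z = deriv (deriv f) z)
    (hgne : ∀ z ∈ clDstrip, g z ≠ 0)
    (hglim : ∀ ε > 0, ∃ R : ℝ, ∀ z ∈ clDstrip, R ≤ |z.re| → ‖g z - 1‖ < ε)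
    -- `w = Im f - Im ζ` and its gradient, extended continuously to the closed strip
    (hwc : ContinuousOn w clDstrip)
    (hwxc : ContinuousOn wx clDstrip) (hwyc : ContinuousOn wy clDstrip)
    (hwe : ∀ z ∈ Dstrip, w z = (f z).im - z.im)
    (hwde : ∀ z ∈ Dstrip, wx z = pdxC w z ∧ wy z = pdyC w z)
    -- `w` and its derivatives up to second order tend to `0` as `|Re ζ| → ∞`, uniformly
    (hwdecay : ∀ ε > 0, ∃ R : ℝ, ∀ z ∈ clDstrip, R ≤ |z.re| →
      |w z| + |wx z| + |wy z| < ε)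
    (hg2decay : ∀ ε > 0, ∃ R : ℝ, ∀ z ∈ clDstrip, R ≤ |z.re| → ‖g2 z‖ < ε)
    -- the Helmholtz–Kirchhoff condition
    (hHK : deriv (deriv f) (Complex.I * β) / deriv f (Complex.I * β) =
      (Real.pi : ℂ) * Complex.I * κ)
    -- the Bernoulli condition on the surface
    (hBern : ∀ ξ : ℝ,
      1 / 2 * (avort κ β ξ) ^ 2 /
          ((wx ((ξ : ℂ) + Complex.I)) ^ 2 + (1 + wy ((ξ : ℂ) + Complex.I)) ^ 2)
        + w ((ξ : ℂ) + Complex.I) / F ^ 2 = 1 / 2)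
    -- nonpositivity of the conformal vertical velocity
    (hsign : ∀ z : ℂ, 0 < z.re → 0 < z.im → z.im ≤ 1 → z ≠ Complex.I * β →
      -(Wzeta (gammaPV κ β) β z / g z).im ≤ 0) :
    -- strict negativity
    ∀ z : ℂ, 0 < z.re → 0 < z.im → z.im ≤ 1 → z ≠ Complex.I * β →
      -(Wzeta (gammaPV κ β) β z / g z).im < 0 := by
  obtain ⟨hs, hγ⟩ := aux_gamma_neg κ β hβ hκ
  set γ := gammaPV κ β with hγdef
  set h : ℂ → ℂ := fun z => Wzeta γ β z / g z with hh
  have hDo := aux_D_open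
  -- derivatives of `f` and `g` inside the strip
  have hfd : ∀ z ∈ Dstrip, HasDerivAt f (g z) z := by
    intro z hz
    rw [hge z hz]
    exact (hf.differentiableAt (hDo.mem_nhds hz)).hasDerivAt
  have hgd : ∀ z ∈ Dstrip, HasDerivAt g (g2 z) z := by
    intro z hz
    have h1 : DifferentiableAt ℂ (deriv f) z :=
      (hf.deriv hDo).differentiableAt (hDo.mem_nhds hz)
    have h2 : g =ᶠ[nhds z] deriv f := by
      filter_upwards [hDo.mem_nhds hz] with y hy using hge y hy
    rw [hg2e z hz]
    exact h1.hasDerivAt.congr_of_eventuallyEq h2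
  have hQD : auxQ ⊆ Dstrip := fun z hz =>
    ⟨by have : 0 < z.im := hz.2.1; linarith, hz.2.2⟩
  have hpne : ∀ z : ℂ, 0 < z.re → z ≠ Complex.I * β := by
    intro z hz h0
    rw [h0] at hz
    simp at hz
  have hnn : ∀ z : ℂ, 0 < z.re → 0 < z.im → z.im ≤ 1 → 0 ≤ (h z).im := by
    intro z h1 h2 h3
    have := hsign z h1 h2 h3 (hpne z h1)
    linarith
  have hhd : DifferentiableOn ℂ h auxQ := by
    intro z hz
    exact ((aux_W_diff γ β z hz.1).div (hgd z (hQD hz)).differentiableAt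
      (hgne z (aux_D_sub (hQD hz)))).differentiableWithinAt
  -- interior: open mapping theorem
  have hposQ : ∀ z ∈ auxQ, 0 < (h z).im := by
    intro z hz
    refine lt_of_le_of_ne (hnn z hz.1 hz.2.1 hz.2.2.le) ?_
    intro h0
    rcases (hhd.analyticOnNhd auxQ_open).is_constant_or_isOpen auxQ_preconn with ⟨c, hc⟩ | hop
    · refine aux_nonconst γ β hγ.ne hβ g c hs hgc (fun y hy => ?_)
      rw [← hc y hy, hh]
      exact (div_mul_cancel₀ _ (hgne y (aux_D_sub (hQD hy)))).symm
    · have ho := hop auxQ Subset.rfl auxQ_open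
      have hm : h z ∈ h '' auxQ := mem_image_of_mem h hz
      obtain ⟨ε, hε, hball⟩ := Metric.isOpen_iff.mp ho _ hm
      have : h z - (ε / 2 : ℝ) * Complex.I ∈ Metric.ball (h z) ε := by
        rw [Metric.mem_ball, dist_eq_norm]
        simp [abs_of_pos hε]
        exact hε
      obtain ⟨y, hy, hyz⟩ := hball this
      have h1 := hnn y hy.1 hy.2.1 hy.2.2.le
      rw [hyz] at h1
      simp [← h0] at h1
      linarith
  intro z hz1 hz2 hz3 hz4
  change -(h z).im < 0
  rcases lt_or_eq_of_le hz3 with hlt | heq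
  · have := hposQ z ⟨hz1, hz2, hlt⟩
    linarith
  -- boundary
  have hzcl : z ∈ clDstrip := ⟨by linarith, hz3⟩
  obtain ⟨ξ, hξz⟩ : ∃ ξ : ℝ, z = (ξ : ℂ) + Complex.I :=
    ⟨z.re, by apply Complex.ext <;> simp [heq]⟩
  have hξ : 0 < ξ := by rw [hξz] at hz1; simpa using hz1
  by_contra hcon
  have him0 : (h z).im = 0 := le_antisymm (by linarith) (hnn z hz1 hz2 hz3)
  -- derivative of `g` up to the boundary
  have hgF := aux_ext g (fun z => g2 z • (1 : ℂ →L[ℝ] ℂ)) hgc (hg2c.smul continuousOn_const)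
    (fun y hy => (hgd y hy).complexToReal_fderiv) z hzcl
  have hgD : HasDerivWithinAt g (g2 z) clDstrip z := by
    rw [hasDerivWithinAt_iff_hasFDerivWithinAt]
    refine HasFDerivWithinAt.of_restrictScalars ℝ hgF ?_
    ext <;> simp [mul_comm]
  obtain ⟨h', hhD⟩ : ∃ h', HasDerivWithinAt h h' clDstrip z :=
    ⟨_, (aux_W_diff γ β z hz1).hasDerivAt.hasDerivWithinAt.div hgD (hgne z hzcl)⟩
  -- derivative of `w` up to the boundary
  have hwD : ∀ y ∈ Dstrip, HasFDerivAt w (Complex.imCLM ∘L ((g y - 1) • (1 : ℂ →L[ℝ] ℂ))) y := by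
    intro y hy
    have h1 : HasDerivAt (fun x => f x - x) (g y - 1) y := (hfd y hy).sub (hasDerivAt_id y)
    have h2 := Complex.imCLM.hasFDerivAt.comp y h1.complexToReal_fderiv
    refine h2.congr_of_eventuallyEq ?_
    filter_upwards [hDo.mem_nhds hy] with x hx
    simp [hwe x hx]
  have hwF := aux_ext w _ hwc (by
    refine ContinuousOn.clm_comp continuousOn_const ?_
    exact (hgc.sub continuousOn_const).smul continuousOn_const) hwD z hzcl
  have hwx : ∀ y ∈ Dstrip, wx y = (g y).im := by
    intro y hy
    rw [(hwde y hy).1, pdxC]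
    have h1 : HasDerivAt (fun x : ℝ => (x : ℂ) + (y.im : ℂ) * Complex.I) 1 y.re :=
      (Complex.ofRealCLM.hasDerivAt (x := y.re)).add_const _
    have h2 := (hwD y hy)
    have e : (y.re : ℂ) + (y.im : ℂ) * Complex.I = y := Complex.re_add_im y
    have h3 := HasFDerivAt.comp_hasDerivAt_of_eq y.re h2 h1 e.symm
    have h4 := h3.deriv
    simp [Function.comp_def] at h4
    simpa using h4
  have hwy : ∀ y ∈ Dstrip, wy y = (g y).re - 1 := by
    intro y hy
    rw [(hwde y hy).2, pdyC]
    have h1 : HasDerivAt (fun x : ℝ => (y.re : ℂ) + (x : ℂ) * Complex.I) Complex.I y.im := by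
      have := ((Complex.ofRealCLM.hasDerivAt (x := y.im)).mul_const Complex.I).const_add (y.re : ℂ)
      simpa using this
    have h2 := (hwD y hy)
    have e : (y.re : ℂ) + (y.im : ℂ) * Complex.I = y := Complex.re_add_im y
    have h3 := HasFDerivAt.comp_hasDerivAt_of_eq y.im h2 h1 e.symm
    have h4 := h3.deriv
    simp [Function.comp_def] at h4
    simpa using h4
  have hclo : clDstrip ⊆ closure Dstrip := aux_D_closure.symm.subset
  have hwx' : EqOn wx (fun y => (g y).im) clDstrip :=
    EqOn.of_subset_closure hwx hwxc (Complex.continuous_im.comp_continuousOn hgc) aux_D_sub hclo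
  have hwy' : EqOn wy (fun y => (g y).re - 1) clDstrip :=
    EqOn.of_subset_closure hwy hwyc
      ((Complex.continuous_re.comp_continuousOn hgc).sub continuousOn_const) aux_D_sub hclo
  -- surface values
  have hsc : ∀ x : ℝ, (x : ℂ) + Complex.I ∈ clDstrip := by
    intro x; constructor <;> simp
  have hapos : 0 < avort κ β ξ := aux_a_pos κ β ξ hβ hκ
  have hW : Wzeta γ β z = (avort κ β ξ : ℂ) := by rw [hξz]; exact aux_W_surf κ β ξ hξ
  have hhz : h z = (avort κ β ξ : ℂ) / g z := by rw [hh]; simp only [hW]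
  have hgim : (g z).im = 0 := by
    have h1 := him0
    rw [hhz, Complex.div_im] at h1
    have h2 : Complex.normSq (g z) ≠ 0 := by simpa using hgne z hzcl
    simp [h2, hapos.ne'] at h1
    exact h1
  have hhre : (h z).re ≠ 0 := by
    intro h0
    have : h z = 0 := Complex.ext h0 him0
    rw [hhz, div_eq_zero_iff] at this
    rcases this with h1 | h1
    · exact hapos.ne' (by exact_mod_cast h1)
    · exact hgne z hzcl h1
  have hBern' : ∀ᶠ x : ℝ in nhds ξ, (h ((x : ℂ) + Complex.I)).re ^ 2
      + (h ((x : ℂ) + Complex.I)).im ^ 2 + 2 / F ^ 2 * w ((x : ℂ) + Complex.I) = 1 := by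
    filter_upwards [lt_mem_nhds hξ] with x hx
    have h1 := hBern x
    rw [hwx' (hsc x), hwy' (hsc x)] at h1
    have h2 : (h ((x : ℂ) + Complex.I)).re ^ 2 + (h ((x : ℂ) + Complex.I)).im ^ 2
        = (avort κ β x) ^ 2 / ((g ((x : ℂ) + Complex.I)).im ^ 2
          + (1 + ((g ((x : ℂ) + Complex.I)).re - 1)) ^ 2) := by
      have e1 : h ((x : ℂ) + Complex.I) = (avort κ β x : ℂ) / g ((x : ℂ) + Complex.I) := by
        rw [hh]; simp only [hγdef, aux_W_surf κ β x hx]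
      have e2 : Complex.normSq (h ((x : ℂ) + Complex.I))
          = (avort κ β x) ^ 2 / Complex.normSq (g ((x : ℂ) + Complex.I)) := by
        rw [e1, Complex.normSq_div, Complex.normSq_ofReal, sq]
      rw [Complex.normSq_apply, Complex.normSq_apply] at e2
      rw [sq, sq, e2]
      congr 1
      ring
    rw [h2]
    linear_combination 2 * h1
  -- derivatives along the surface
  have hpath : HasDerivAt (fun x : ℝ => (x : ℂ) + Complex.I) 1 ξ :=
    (Complex.ofRealCLM.hasDerivAt (x := ξ)).add_const _
  have hhF := hhD.complexToReal_fderiv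
  have hhP : HasDerivAt (fun x : ℝ => h ((x : ℂ) + Complex.I)) h' ξ := by
    have := HasFDerivWithinAt.comp_hasDerivAt_of_eq ξ hhF hpath
      (Filter.Eventually.of_forall hsc) hξz
    simpa [Function.comp_def] using this
  have hwP : HasDerivAt (fun x : ℝ => w ((x : ℂ) + Complex.I)) 0 ξ := by
    have := HasFDerivWithinAt.comp_hasDerivAt_of_eq ξ hwF hpath
      (Filter.Eventually.of_forall hsc) hξz
    simpa [Function.comp_def, hgim] using this
  have hreP : HasDerivAt (fun x : ℝ => (h ((x : ℂ) + Complex.I)).re) h'.re ξ :=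
    Complex.reCLM.hasFDerivAt.comp_hasDerivAt ξ hhP
  have himP : HasDerivAt (fun x : ℝ => (h ((x : ℂ) + Complex.I)).im) h'.im ξ :=
    Complex.imCLM.hasFDerivAt.comp_hasDerivAt ξ hhP
  have him' : h'.im = 0 := by
    refine IsLocalMin.hasDerivAt_eq_zero ?_ himP
    filter_upwards [lt_mem_nhds hξ] with x hx
    rw [← hξz, him0]
    exact hnn _ (by simpa using hx) (by simp) (by simp)
  have hre' : h'.re = 0 := by
    have h1 := (((hreP.pow 2).add (himP.pow 2)).add (hwP.const_mul (2 / F ^ 2)))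
    have h2 : HasDerivAt (fun _ : ℝ => (1 : ℝ)) 0 ξ := hasDerivAt_const _ _
    have h3 := h1.unique (h2.congr_of_eventuallyEq hBern')
    rw [him', ← hξz] at h3
    simpa [hhre] using h3
  have hh'0 : h' = 0 := Complex.ext hre' him'
  rw [hh'0] at hhD
  -- Hopf lemma
  obtain ⟨r, hr0, hrξ, hr1⟩ : ∃ r : ℝ, 0 < r ∧ r ≤ ξ ∧ r ≤ 1 / 2 :=
    ⟨min ξ (1 / 2), lt_min hξ (by norm_num), min_le_left _ _, min_le_right _ _⟩
  set c : ℂ := (ξ : ℂ) + (1 - r : ℝ) * Complex.I with hc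
  have hcre : c.re = ξ := by simp [hc]
  have hcim : c.im = 1 - r := by simp [hc]
  have hball : Metric.ball c r ⊆ auxQ := by
    intro y hy
    rw [Metric.mem_ball, dist_eq_norm] at hy
    have h1 := (abs_lt.mp (lt_of_le_of_lt (Complex.abs_re_le_norm (y - c)) hy))
    have h2 := (abs_lt.mp (lt_of_le_of_lt (Complex.abs_im_le_norm (y - c)) hy))
    simp only [Complex.sub_re, Complex.sub_im, hcre, hcim] at h1 h2
    exact ⟨show (0 : ℝ) < y.re by linarith, show (0 : ℝ) < y.im by linarith,
      show y.im < 1 by linarith⟩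
  have hopf := aux_hopf h c r (hhd.mono hball) (fun y hy => hposQ y (hball hy))
  have hq : 0 < (h c).im := hposQ c (hball (Metric.mem_ball_self hr0))
  have hlo := hasDerivWithinAt_iff_isLittleO.mp hhD
  have hlo2 := hlo.def (show (0 : ℝ) < (h c).im / (8 * r) by positivity)
  rw [Filter.Eventually, Metric.mem_nhdsWithin_iff] at hlo2
  obtain ⟨δ, hδ, hsub⟩ := hlo2
  obtain ⟨t, ht0, htr, htδ⟩ : ∃ t : ℝ, 0 < t ∧ t < r ∧ t < δ :=
    ⟨min r δ / 2, by positivity, by linarith [min_le_left r δ, lt_min hr0 hδ],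
      by linarith [min_le_right r δ, lt_min hr0 hδ]⟩
  set y : ℂ := (ξ : ℂ) + (1 - t : ℝ) * Complex.I with hy
  have hyz : y - z = ((-t : ℝ) : ℂ) * Complex.I := by rw [hy, hξz]; push_cast; ring
  have hyc : y - c = ((r - t : ℝ) : ℂ) * Complex.I := by rw [hy, hc]; push_cast; ring
  have hnyz : ‖y - z‖ = t := by
    rw [hyz, norm_mul, Complex.norm_I, mul_one, Complex.norm_real, Real.norm_eq_abs, abs_neg,
      abs_of_pos ht0]
  have hnyc : dist y c = r - t := by
    rw [dist_eq_norm, hyc, norm_mul, Complex.norm_I, mul_one, Complex.norm_real,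
      Real.norm_eq_abs, abs_of_pos (by linarith)]
  have hyim : y.im = 1 - t := by simp [hy]
  have h1 := hsub ⟨by rw [Metric.mem_ball, dist_eq_norm, hnyz]; exact htδ,
    show y ∈ clDstrip from ⟨by rw [hyim]; linarith, by rw [hyim]; linarith⟩⟩
  simp only [mem_ofPred_eq, smul_zero, sub_zero, hnyz] at h1
  have h2 := hopf y (by rw [Metric.mem_ball, hnyc]; linarith)
  rw [hnyc] at h2
  have h3 := (le_abs_self _).trans (Complex.abs_im_le_norm (h y - h z))
  rw [Complex.sub_im, him0, sub_zero] at h3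
  have h4 : t / r ≤ 1 - ((r - t) / r) ^ 2 := by
    have e : (r - t) / r = 1 - t / r := by field_simp
    have e1 : 0 < t / r := by positivity
    have e2 : t / r < 1 := by rw [div_lt_one hr0]; exact htr
    rw [e]; nlinarith
  have h5 := mul_le_mul_of_nonneg_left h4 hq.le
  have h6 : (h c).im / (8 * r) * t = (h c).im * (t / r) / 8 := by field_simp
  have h7 : 0 < (h c).im * (t / r) := by positivity
  linarith
end

section
/- Let λ > 0, γ ∈ ℝ, β ∈ (0,1). Let Λ := {2λm + 2ni : m, n ∈ ℤ}, let σ(z) := z·∏_{ℓ ∈ Λ\{0}} (1 − z/ℓ)·exp(z/ℓ + z²/(2ℓ²)) be the Weierstrass sigma function of Λ, and ζ_W := σ'/σ its logarithmic derivative. Define W_ζ(ζ) := (γ/(2πi))·( ζ_W(ζ − iβ) − ζ_W(ζ + iβ) + 2β·ζ_W(i) ) + 1. Then: (i) W_ζ is meromorphic on ℂ, and its poles in the closed strip {|Im ζ| ≤ 1} are simple poles located exactly at the points ±iβ + 2λℤ, with residue γ/(2πi) at each point of iβ + 2λℤ and residue −γ/(2πi) at each point of −iβ + 2λℤ; (ii)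 W_ζ(ζ + 2λ) = W_ζ(ζ) for all ζ; (iii) W_ζ is real-valued on {Im ζ = 0} \ (poles), on {Im ζ = 1}, and on the imaginary axis away from its poles; (iv) Im ∫ W_ζ(ζ) dζ = 1, where the integral is taken along the vertical segment from λ to λ + i. -/
open Set

/-- The lattice `Λ = 2λℤ × 2ℤi ⊆ ℂ`. -/
def latt (lam : ℝ) : Set ℂ :=
  {z : ℂ | ∃ m n : ℤ, z = 2 * (lam : ℂ) * (m : ℂ) + 2 * (n : ℂ) * Complex.I}

/-- The Weierstrass sigma function of the lattice `Λ`. -/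
noncomputable def wsigma (lam : ℝ) (z : ℂ) : ℂ :=
  z * ∏' l : {w : ℂ // w ∈ latt lam ∧ w ≠ 0},
    (1 - z / (l : ℂ)) * Complex.exp (z / (l : ℂ) + z ^ 2 / (2 * (l : ℂ) ^ 2))

/-- The Weierstrass zeta function `ζ_W = σ'/σ`. -/
noncomputable def wzetaW (lam : ℝ) (z : ℂ) : ℂ :=
  deriv (wsigma lam) z / wsigma lam z

/-- The derivative `W_ζ` of the periodic complex relative velocity potential. -/
noncomputable def WzP (lam γ β : ℝ) (z : ℂ) : ℂ :=
  (γ : ℂ) / (2 * (Real.pi : ℂ) * Complex.I) *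
    (wzetaW lam (z - Complex.I * β) - wzetaW lam (z + Complex.I * β) +
      2 * (β : ℂ) * wzetaW lam Complex.I) + 1

open Filter Topology

/-- The period pair of the lattice. -/
noncomputable def wPP (lam : ℝ) (hlam : 0 < lam) : PeriodPair where
  ω₁ := 2 * (lam : ℂ)
  ω₂ := 2 * Complex.I
  indep := by
    rw [LinearIndependent.pair_iff]
    intro s t h
    have h1 := congrArg Complex.re h
    have h2 := congrArg Complex.im h
    simp at h1 h2
    refine ⟨?_, h2⟩
    rcases h1 with h1 | h1
    · exact h1
    · exact absurd h1 hlam.ne'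

lemma mem_latt_iff (lam : ℝ) (hlam : 0 < lam) (z : ℂ) :
    z ∈ latt lam ↔ z ∈ (wPP lam hlam).lattice := by
  rw [PeriodPair.mem_lattice]
  constructor
  · rintro ⟨m, n, rfl⟩
    exact ⟨m, n, by simp [wPP]; ring⟩
  · rintro ⟨m, n, rfl⟩
    exact ⟨m, n, by simp [wPP]; ring⟩

/-- Weierstrass factor. -/
noncomputable def wfac (l z : ℂ) : ℂ :=
  (1 - z / l) * Complex.exp (z / l + z ^ 2 / (2 * l ^ 2))

lemma wfac_zero (z : ℂ) : wfac 0 z = 1 := by simp [wfac]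

lemma wfac_differentiable (l : ℂ) : Differentiable ℂ (wfac l) := by
  unfold wfac; fun_prop

lemma wfac_bound (u : ℂ) (hu : ‖u‖ ≤ 1 / 2) :
    ‖(1 - u) * Complex.exp (u + u ^ 2 / 2) - 1‖ ≤ 2 * ‖u‖ ^ 3 := by
  have hne : (1 - u) ≠ 0 := by
    intro h
    have : u = 1 := by linear_combination -h
    rw [this] at hu
    norm_num at hu
  have h1 := Complex.norm_log_sub_logTaylor_le 2 (z := -u) (by rw [norm_neg]; linarith)
  have h2 : Complex.log (1 + -u) - Complex.logTaylor (2 + 1) (-u) =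
      Complex.log (1 - u) + (u + u ^ 2 / 2) := by
    simp [Complex.logTaylor_succ, Complex.logTaylor_zero, ← sub_eq_add_neg]
    ring
  rw [h2, norm_neg] at h1
  have h3 : ‖Complex.log (1 - u) + (u + u ^ 2 / 2)‖ ≤ ‖u‖ ^ 3 := by
    refine h1.trans ?_
    have : (1 - ‖u‖)⁻¹ ≤ 2 := by
      rw [inv_le_comm₀ (by linarith) (by norm_num)]
      linarith
    have h0 : 0 ≤ ‖u‖ ^ 3 := by positivity
    norm_num
    nlinarith
  have h4 : ‖u‖ ^ 3 ≤ 1 := pow_le_one₀ (norm_nonneg _) (by linarith)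
  have h5 := Complex.norm_exp_sub_one_le (h3.trans h4)
  rw [Complex.exp_add, Complex.exp_log hne] at h5
  linarith

lemma wfac_bound' (r : ℝ) (hr : 0 < r) (z : ℂ) (hz : ‖z‖ ≤ r) (l : ℂ) (h : 2 * r ≤ ‖l‖) :
    ‖wfac l z - 1‖ ≤ 2 * r ^ 3 * ‖l‖ ^ (-3 : ℝ) := by
  have hl : 0 < ‖l‖ := by linarith
  have hb : ‖z / l‖ ≤ r / ‖l‖ := by
    rw [norm_div]; gcongr
  have h1 := wfac_bound (z / l) (hb.trans (by rw [div_le_iff₀ hl]; linarith))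
  have h2 : wfac l z = (1 - z / l) * Complex.exp (z / l + (z / l) ^ 2 / 2) := by
    unfold wfac
    congr 3
    rw [div_pow, div_div, mul_comm]
  rw [h2]
  refine h1.trans ?_
  have h3 : ‖l‖ ^ (-3 : ℝ) = (‖l‖ ^ 3)⁻¹ := by
    rw [Real.rpow_neg hl.le]; norm_cast
  rw [h3]
  calc 2 * ‖z / l‖ ^ 3 ≤ 2 * (r / ‖l‖) ^ 3 := by gcongr
    _ = _ := by rw [div_pow]; ring

lemma wfac_eventually (L : PeriodPair) (r : ℝ) (hr : 0 < r) :
    ∀ᶠ l : L.lattice in cofinite, ∀ z ∈ Metric.closedBall (0 : ℂ) r,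
      ‖wfac l z - 1‖ ≤ 2 * r ^ 3 * ‖l‖ ^ (-3 : ℝ) := by
  refine (isCompact_iff_finite.mp (isCompact_closedBall (0 : L.lattice) (2 * r))).subset ?_
  intro l hl
  simp only [Metric.mem_closedBall, dist_zero_right]
  by_contra hc
  apply hl
  intro z hz
  exact wfac_bound' r hr z (by simpa using hz) l (by push Not at hc; exact hc.le)

lemma wsummable (L : PeriodPair) (c : ℝ) :
    Summable fun l : L.lattice => c * ‖l‖ ^ (-3 : ℝ) :=
  (ZLattice.summable_norm_rpow _ _ (by simp; norm_num)).mul_left _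

/-- The sigma function with the zero at the origin removed. -/
noncomputable def wg (L : PeriodPair) (z : ℂ) : ℂ := ∏' l : L.lattice, wfac l z

lemma wprod (L : PeriodPair) :
    MultipliableLocallyUniformlyOn (fun l : L.lattice => wfac l) Set.univ := by
  apply multipliableLocallyUniformlyOn_of_of_forall_exists_nhds
  intro x _
  refine ⟨Metric.closedBall 0 (‖x‖ + 1), ?_, ?_⟩
  · rw [nhdsWithin_univ]
    exact Filter.mem_of_superset (Metric.isOpen_ball.mem_nhds (show x ∈ Metric.ball (0 : ℂ) (‖x‖ + 1) by simp))
      Metric.ball_subset_closedBall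
  · have hr : 0 < ‖x‖ + 1 := by positivity
    have := Summable.multipliableUniformlyOn_one_add (f := fun (l : L.lattice) z => wfac l z - 1)
      (isCompact_closedBall (0 : ℂ) (‖x‖ + 1)) (wsummable L (2 * (‖x‖ + 1) ^ 3))
      (wfac_eventually L (‖x‖ + 1) hr)
      (fun i => (((wfac_differentiable i).continuous).sub continuous_const).continuousOn)
    simpa using this

lemma wg_differentiable (L : PeriodPair) : Differentiable ℂ (wg L) := by
  rw [← differentiableOn_univ]
  refine TendstoLocallyUniformlyOn.differentiableOn (wprod L).hasProdLocallyUniformlyOn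
    (.of_forall fun s => ?_) isOpen_univ
  have : ∀ l : L.lattice, Differentiable ℂ (wfac l) := fun l => wfac_differentiable l
  fun_prop

lemma wfac_ne (l z : ℂ) (h : l = 0 ∨ z ≠ l) : wfac l z ≠ 0 := by
  by_cases hl : l = 0
  · subst hl; simp [wfac_zero]
  · have := h.resolve_left hl
    unfold wfac
    refine mul_ne_zero ?_ (Complex.exp_ne_zero _)
    intro h0
    apply this
    field_simp at h0
    linear_combination -h0

lemma wg_ne (L : PeriodPair) (z : ℂ) (h : z = 0 ∨ z ∉ L.lattice) : wg L z ≠ 0 := by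
  have hs : Summable fun l : L.lattice => ‖wfac l z - 1‖ := by
    refine (wsummable L (2 * (‖z‖ + 1) ^ 3)).of_norm_bounded_eventually ?_
    filter_upwards [wfac_eventually L (‖z‖ + 1) (by positivity)] with l hl
    rw [norm_norm]
    exact hl z (by simp)
  have := tprod_one_add_ne_zero_of_summable (f := fun l : L.lattice => wfac l z - 1) ?_ hs
  · simpa [wg] using this
  · intro l
    rw [add_sub_cancel]
    apply wfac_ne
    rcases h with rfl | h
    · by_cases h : l.1 = 0
      · exact .inl h
      · exact .inr (Ne.symm h)
    · exact .inr (by rintro rfl; exact h l.2)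

lemma wg_eq_zero (L : PeriodPair) (z : ℂ) (h : z ≠ 0) (h' : z ∈ L.lattice) : wg L z = 0 := by
  apply tprod_of_exists_eq_zero
  refine ⟨⟨z, h'⟩, ?_⟩
  simp [wfac, div_self h]

lemma wsigma_eq (lam : ℝ) (hlam : 0 < lam) (z : ℂ) : wsigma lam z = z * wg (wPP lam hlam) z := by
  unfold wsigma wg
  congr 1
  let e : {w : ℂ // w ∈ latt lam ∧ w ≠ 0} → (wPP lam hlam).lattice :=
    fun w => ⟨w.1, (mem_latt_iff lam hlam _).1 w.2.1⟩
  have he : Function.Injective e := by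
    intro a b hab
    exact Subtype.ext (congrArg (fun t : (wPP lam hlam).lattice => (t : ℂ)) hab)
  refine he.tprod_eq (f := fun l : (wPP lam hlam).lattice => wfac l z) ?_
  intro l hl
  have : l.1 ≠ 0 := by
    intro h0
    apply hl
    simp only [h0, wfac_zero]
  exact ⟨⟨l.1, (mem_latt_iff lam hlam _).2 l.2, this⟩, rfl⟩

lemma wsigma_differentiable (lam : ℝ) (hlam : 0 < lam) : Differentiable ℂ (wsigma lam) := by
  have : wsigma lam = fun z => z * wg (wPP lam hlam) z := funext (wsigma_eq lam hlam)
  rw [this]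
  exact differentiable_id.mul (wg_differentiable _)

lemma wsigma_ne (lam : ℝ) (hlam : 0 < lam) (z : ℂ) : wsigma lam z ≠ 0 ↔ z ∉ latt lam := by
  rw [wsigma_eq lam hlam, mem_latt_iff lam hlam]
  constructor
  · intro h h'
    by_cases h0 : z = 0
    · simp [h0] at h
    · rw [wg_eq_zero _ _ h0 h'] at h
      simp at h
  · intro h
    refine mul_ne_zero ?_ (wg_ne _ _ (.inr h))
    rintro rfl
    exact h (Submodule.zero_mem _)

lemma wzetaW_eq_logDeriv (lam : ℝ) (hlam : 0 < lam) (z : ℂ) (h0 : z ≠ 0)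
    (hg : wg (wPP lam hlam) z ≠ 0) :
    wzetaW lam z = z⁻¹ + logDeriv (wg (wPP lam hlam)) z := by
  have : wsigma lam = fun z => z * wg (wPP lam hlam) z := funext (wsigma_eq lam hlam)
  have h1 : wzetaW lam z = logDeriv (wsigma lam) z := rfl
  rw [h1, this, logDeriv_mul (f := fun z : ℂ => z) z h0 hg differentiableAt_id
    (wg_differentiable _ _)]
  simp [logDeriv]

/-- zeta series summand -/
noncomputable def wzt (l z : ℂ) : ℂ := 1 / (z - l) + 1 / l + z / l ^ 2

lemma logDeriv_wfac (l z : ℂ) (h : z ≠ l) (hl : l ≠ 0) : logDeriv (wfac l) z = wzt l z := by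
  have h1 : (1 - z / l) ≠ 0 := by
    intro h0; apply h; field_simp at h0; linear_combination -h0
  have h2 : z - l ≠ 0 := sub_ne_zero.2 h
  have hd1 : HasDerivAt (fun z : ℂ => 1 - z / l) (-(1 / l)) z := by
    simpa using ((hasDerivAt_id z).div_const l).const_sub 1
  have hd2 : HasDerivAt (fun z : ℂ => z / l + z ^ 2 / (2 * l ^ 2)) (1 / l + 2 * z / (2 * l ^ 2)) z := by
    simpa using ((hasDerivAt_id z).div_const l).fun_add ((hasDerivAt_pow 2 z).div_const (2 * l ^ 2))
  have hd := hd1.mul hd2.cexp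
  have : logDeriv (wfac l) z = deriv (wfac l) z / wfac l z := rfl
  rw [this, show wfac l = ((fun z : ℂ => 1 - z / l) * fun z : ℂ => Complex.exp (z / l + z ^ 2 / (2 * l ^ 2))) from rfl, hd.deriv]
  simp only [Pi.mul_apply]
  have h3 : l - z ≠ 0 := sub_ne_zero.2 h.symm
  have he := Complex.exp_ne_zero (z / l + z ^ 2 / (2 * l ^ 2))
  generalize Complex.exp (z / l + z ^ 2 / (2 * l ^ 2)) = E at *
  have : wzt l z = (-(1 / l) + (1 - z / l) * (1 / l + 2 * z / (2 * l ^ 2))) / (1 - z / l) := by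
    unfold wzt
    rw [eq_div_iff h1]
    field_simp
    ring
  rw [this]
  field_simp

lemma wzt_bound (r : ℝ) (hr : 0 < r) (z : ℂ) (hz : ‖z‖ < r) (l : ℂ) (h : 2 * r ≤ ‖l‖) :
    ‖wzt l z‖ ≤ 2 * r ^ 2 * ‖l‖ ^ (-3 : ℝ) := by
  have hl : 0 < ‖l‖ := by linarith
  have hl0 : l ≠ 0 := norm_pos_iff.1 hl
  have h2 : ‖l‖ / 2 ≤ ‖z - l‖ := by
    rw [norm_sub_rev]
    have := norm_sub_norm_le l z
    linarith
  have h3 : z - l ≠ 0 := norm_pos_iff.1 (by linarith)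
  have h4 : wzt l z = z ^ 2 / (l ^ 2 * (z - l)) := by
    unfold wzt; field_simp; ring
  have h5 : ‖l‖ ^ (-3 : ℝ) = (‖l‖ ^ 3)⁻¹ := by
    rw [Real.rpow_neg hl.le]; norm_cast
  rw [h4, h5, norm_div, norm_mul, norm_pow, norm_pow]
  calc ‖z‖ ^ 2 / (‖l‖ ^ 2 * ‖z - l‖) ≤ r ^ 2 / (‖l‖ ^ 2 * (‖l‖ / 2)) := by gcongr
    _ = _ := by field_simp

/-- zeta series -/
noncomputable def wZ (L : PeriodPair) (z : ℂ) : ℂ := ∑' l : L.lattice, wzt l z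

lemma wZ_hasSum (L : PeriodPair) : HasSumLocallyUniformly (fun l : L.lattice => wzt l) (wZ L) := by
  refine L.hasSumLocallyUniformly_aux (u := fun r l => 2 * r ^ 2 * ‖l‖ ^ (-3 : ℝ)) _
    (fun _ _ ↦ wsummable L _) fun r hr ↦ Filter.eventually_atTop.mpr ⟨2 * r, ?_⟩
  rintro _ h s hs l rfl
  exact wzt_bound r hr s hs l h

lemma wzt_hasDerivAt (l z : ℂ) (h : z ≠ l) :
    HasDerivAt (wzt l) (-(1 / (z - l) ^ 2 - 1 / l ^ 2)) z := by
  have h1 : z - l ≠ 0 := sub_ne_zero.2 h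
  have h2 : HasDerivAt (fun z : ℂ => z - l) 1 z := (hasDerivAt_id z).sub_const l
  have h3 := (((h2.inv h1).add_const (1 / l)).fun_add ((hasDerivAt_id z).div_const (l ^ 2)))
  have : wzt l = fun z => (z - l)⁻¹ + 1 / l + id z / l ^ 2 := by
    funext z; simp [wzt]
  rw [this]
  refine h3.congr_deriv ?_
  ring

lemma wZ_differentiableOn (L : PeriodPair) : DifferentiableOn ℂ (wZ L) (L.lattice : Set ℂ)ᶜ := by
  refine TendstoLocallyUniformlyOn.differentiableOn
    (wZ_hasSum L).hasSumLocallyUniformlyOn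
    (.of_forall fun s => .fun_sum fun i hi => ?_) L.isClosed_lattice.isOpen_compl
  intro z hz
  exact (wzt_hasDerivAt i z (by rintro rfl; exact hz i.2)).differentiableAt.differentiableWithinAt

lemma wZ_deriv (L : PeriodPair) (z : ℂ) (hz : z ∉ L.lattice) :
    deriv (wZ L) z = - L.weierstrassP z := by
  have h1 := (TendstoLocallyUniformlyOn.deriv
    (wZ_hasSum L).hasSumLocallyUniformlyOn
    (.of_forall fun s => .fun_sum fun i hi => ?_) L.isClosed_lattice.isOpen_compl).tendsto_at hz
  · refine tendsto_nhds_unique h1 ?_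
    refine (L.hasSum_weierstrassP z).neg.congr fun s => ?_
    simp only [Function.comp_apply]
    rw [deriv_fun_sum]
    · refine Finset.sum_congr rfl fun l _ => ?_
      exact (wzt_hasDerivAt l z (by rintro rfl; exact hz l.2)).deriv.symm
    · intro l _
      exact (wzt_hasDerivAt l z (by rintro rfl; exact hz l.2)).differentiableAt
  · intro z hz
    exact (wzt_hasDerivAt i z (by rintro rfl; exact hz i.2)).differentiableAt.differentiableWithinAt

lemma wZ_neg (L : PeriodPair) (z : ℂ) : wZ L (-z) = - wZ L z := by
  simp only [wZ]
  rw [← (Equiv.neg L.lattice).tsum_eq, ← tsum_neg]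
  congr with l
  simp only [wzt, Equiv.neg_apply, NegMemClass.coe_neg]
  rw [show -z - -(l : ℂ) = -(z - l) by ring]
  simp only [div_neg, neg_div, even_two, Even.neg_pow]
  ring

lemma wZ_add (L : PeriodPair) (w : ℂ) (hw : w ∈ L.lattice) (hw2 : w / 2 ∉ L.lattice) (z : ℂ)
    (hz : z ∉ L.lattice) : wZ L (z + w) = wZ L z + 2 * wZ L (w / 2) := by
  have hmem : ∀ x, x ∉ L.lattice → x + w ∉ L.lattice := fun x hx h =>
    hx (by simpa using L.lattice.sub_mem h hw)
  have hdiff : ∀ x, x ∉ L.lattice → DifferentiableAt ℂ (wZ L) x := fun x hx =>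
    (wZ_differentiableOn L).differentiableAt (L.isClosed_lattice.isOpen_compl.mem_nhds hx)
  have hd : ∀ x, x ∉ L.lattice → HasDerivAt (fun y => wZ L (y + w) - wZ L y) 0 x := by
    intro x hx
    have h1 := (hdiff _ (hmem x hx)).hasDerivAt.comp_add_const x w
    have h2 := h1.fun_sub (hdiff x hx).hasDerivAt
    rw [wZ_deriv L _ (hmem x hx), wZ_deriv L x hx] at h2
    have h3 := L.weierstrassP_add_coe x ⟨w, hw⟩
    simp only at h3
    rw [h3, sub_self] at h2
    exact h2
  have hconn : IsPreconnected (L.lattice : Set ℂ)ᶜ := by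
    refine (Set.Countable.isConnected_compl_of_one_lt_rank (by simp) ?_).isPreconnected
    exact countable_of_Lindelof_of_discrete (X := L.lattice)
  have hc := L.isClosed_lattice.isOpen_compl.is_const_of_deriv_eq_zero hconn
    (f := fun y => wZ L (y + w) - wZ L y)
    (fun x hx => (hd x hx).differentiableAt.differentiableWithinAt)
    (fun x hx => (hd x hx).deriv) (x := z) (y := -(w / 2)) hz (by simpa using hw2)
  rw [show -(w / 2) + w = w / 2 by ring, wZ_neg] at hc
  linear_combination hc

lemma wzetaW_eq (lam : ℝ) (hlam : 0 < lam) (z : ℂ) (hz : z ∉ latt lam) :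
    wzetaW lam z = wZ (wPP lam hlam) z := by
  set L := wPP lam hlam with hL
  rw [mem_latt_iff lam hlam, ← hL] at hz
  have h0 : z ≠ 0 := by rintro rfl; exact hz (Submodule.zero_mem _)
  have hne : ∀ l : L.lattice, z ≠ l := by rintro l rfl; exact hz l.2
  have hgne := wg_ne L z (.inr hz)
  have hlog : ∀ l : L.lattice, logDeriv (wfac l) z = wzt l z - (if l = 0 then z⁻¹ else 0) := by
    intro l
    split_ifs with h
    · subst h
      have : wfac ((0 : L.lattice) : ℂ) = fun _ => 1 := by funext z; simp [wfac_zero]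
      rw [this]
      simp [wzt, logDeriv]
    · rw [sub_zero]
      exact logDeriv_wfac l z (hne l) (by simpa using h)
  have hs1 : HasSum (fun l : L.lattice => wzt l z) (wZ L z) := (wZ_hasSum L).hasSum
  have hs2 : HasSum (fun l : L.lattice => (if l = 0 then z⁻¹ else 0)) z⁻¹ := hasSum_ite_eq 0 _
  have hs : HasSum (fun l : L.lattice => logDeriv (wfac l) z) (wZ L z - z⁻¹) := by
    simp_rw [hlog]
    exact hs1.sub hs2
  have := logDeriv_tprod_eq_tsum isOpen_univ (Set.mem_univ z) (f := fun l : L.lattice => wfac l)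
    (fun l => wfac_ne l z (.inr (hne l))) (fun l => (wfac_differentiable l).differentiableOn)
    hs.summable (wprod L) hgne
  rw [wzetaW_eq_logDeriv lam hlam z h0 hgne]
  have h2 : logDeriv (wg L) z = wZ L z - z⁻¹ := this.trans hs.tsum_eq
  rw [← hL, h2]
  ring

lemma wZ_conj (lam : ℝ) (hlam : 0 < lam) (z : ℂ) :
    wZ (wPP lam hlam) (starRingEnd ℂ z) = starRingEnd ℂ (wZ (wPP lam hlam) z) := by
  set L := wPP lam hlam with hL
  have hc : ∀ w ∈ L.lattice, starRingEnd ℂ w ∈ L.lattice := by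
    intro w hw
    rw [hL, ← mem_latt_iff] at hw ⊢
    obtain ⟨m, n, rfl⟩ := hw
    exact ⟨m, -n, by simp [map_ofNat]⟩
  let e : L.lattice ≃ L.lattice :=
    { toFun := fun l => ⟨starRingEnd ℂ l, hc l l.2⟩
      invFun := fun l => ⟨starRingEnd ℂ l, hc l l.2⟩
      left_inv := fun l => by simp
      right_inv := fun l => by simp }
  simp only [wZ]
  rw [← e.tsum_eq, Complex.conj_tsum]
  congr with l
  simp [wzt, e]

lemma latt_cases {lam : ℝ} {z : ℂ} (h : z ∈ latt lam) :
    ∃ m n : ℤ, z.re = 2 * lam * m ∧ z.im = 2 * n := by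
  obtain ⟨m, n, rfl⟩ := h
  exact ⟨m, n, by simp, by simp⟩

lemma not_latt_of_im {lam : ℝ} {z : ℂ} (h0 : 0 < z.im) (h2 : z.im < 2) : z ∉ latt lam := by
  intro h
  obtain ⟨m, n, -, hn⟩ := latt_cases h
  rw [hn] at h0 h2
  have h3 : (0 : ℝ) < n := by linarith
  have h4 : (n : ℝ) < 1 := by linarith
  have h5 : 0 < n := by exact_mod_cast h3
  have h6 : n < 1 := by exact_mod_cast h4
  omega

lemma not_latt_of_re {lam : ℝ} (hlam : 0 < lam) {z : ℂ} (h : z.re = lam) : z ∉ latt lam := by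
  intro h'
  obtain ⟨m, n, hm, -⟩ := latt_cases h'
  rw [h] at hm
  have h1 : (1 : ℝ) = 2 * m := by
    have : lam * (1 - 2 * m) = 0 := by linear_combination hm
    rcases mul_eq_zero.1 this with h | h
    · exact absurd h hlam.ne'
    · linear_combination h
  have h2 : (1 : ℤ) = 2 * m := by exact_mod_cast h1
  omega

lemma latt_neg {lam : ℝ} {z : ℂ} (h : z ∈ latt lam) : -z ∈ latt lam := by
  obtain ⟨m, n, rfl⟩ := h
  exact ⟨-m, -n, by push_cast; ring⟩

lemma latt_conj {lam : ℝ} {z : ℂ} (h : z ∈ latt lam) : starRingEnd ℂ z ∈ latt lam := by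
  obtain ⟨m, n, rfl⟩ := h
  exact ⟨m, -n, by simp [map_ofNat]⟩

lemma latt_add_int {lam : ℝ} {z : ℂ} (m : ℤ) (h : z + 2 * lam * m ∈ latt lam) : z ∈ latt lam := by
  obtain ⟨a, b, hab⟩ := h
  exact ⟨a - m, b, by push_cast; linear_combination hab⟩

lemma latt_add_I {lam : ℝ} {z : ℂ} (h : z + 2 * Complex.I ∈ latt lam) : z ∈ latt lam := by
  obtain ⟨a, b, hab⟩ := h
  exact ⟨a, b - 1, by push_cast; linear_combination hab⟩

lemma I_not_latt (lam : ℝ) : Complex.I ∉ latt lam := not_latt_of_im (by simp) (by simp)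

lemma lam_not_latt (lam : ℝ) (hlam : 0 < lam) : (lam : ℂ) ∉ latt lam :=
  not_latt_of_re hlam (by simp)

lemma zeta_neg (lam : ℝ) (hlam : 0 < lam) (z : ℂ) (hz : z ∉ latt lam) :
    wzetaW lam (-z) = - wzetaW lam z := by
  rw [wzetaW_eq lam hlam z hz, wzetaW_eq lam hlam (-z) (fun h => hz (by simpa using latt_neg h)),
    wZ_neg]

lemma zeta_conj (lam : ℝ) (hlam : 0 < lam) (z : ℂ) (hz : z ∉ latt lam) :
    wzetaW lam (starRingEnd ℂ z) = starRingEnd ℂ (wzetaW lam z) := by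
  rw [wzetaW_eq lam hlam z hz, wzetaW_eq lam hlam _ (fun h => hz (by simpa using latt_conj h)),
    wZ_conj]

lemma zeta_add_lam (lam : ℝ) (hlam : 0 < lam) (z : ℂ) (hz : z ∉ latt lam) :
    wzetaW lam (z + 2 * lam) = wzetaW lam z + 2 * wzetaW lam lam := by
  have h1 : z + 2 * lam ∉ latt lam := fun h => hz (latt_add_int 1 (by simpa using h))
  have h2 := wZ_add (wPP lam hlam) (2 * lam)
    ((mem_latt_iff lam hlam _).1 ⟨1, 0, by simp⟩)
    (by
      rw [← mem_latt_iff, mul_div_cancel_left₀ _ two_ne_zero]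
      exact lam_not_latt lam hlam) z (by rwa [← mem_latt_iff])
  rw [mul_div_cancel_left₀ _ two_ne_zero] at h2
  rw [wzetaW_eq lam hlam z hz, wzetaW_eq lam hlam _ h1,
    wzetaW_eq lam hlam _ (lam_not_latt lam hlam), h2]

lemma zeta_add_I (lam : ℝ) (hlam : 0 < lam) (z : ℂ) (hz : z ∉ latt lam) :
    wzetaW lam (z + 2 * Complex.I) = wzetaW lam z + 2 * wzetaW lam Complex.I := by
  have h1 : z + 2 * Complex.I ∉ latt lam := fun h => hz (latt_add_I h)
  have h2 := wZ_add (wPP lam hlam) (2 * Complex.I)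
    ((mem_latt_iff lam hlam _).1 ⟨0, 1, by simp⟩)
    (by
      rw [← mem_latt_iff, mul_div_cancel_left₀ _ two_ne_zero]
      exact I_not_latt lam) z (by rwa [← mem_latt_iff])
  rw [mul_div_cancel_left₀ _ two_ne_zero] at h2
  rw [wzetaW_eq lam hlam z hz, wzetaW_eq lam hlam _ h1,
    wzetaW_eq lam hlam _ (I_not_latt lam), h2]

lemma zeta_add_int (lam : ℝ) (hlam : 0 < lam) (z : ℂ) (hz : z ∉ latt lam) (m : ℤ) :
    wzetaW lam (z + 2 * lam * m) = wzetaW lam z + 2 * m * wzetaW lam lam := by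
  have hn : ∀ k : ℤ, z + 2 * lam * k ∉ latt lam := fun k h => hz (latt_add_int k h)
  induction m using Int.induction_on with
  | zero => simp
  | succ k ih =>
    have := zeta_add_lam lam hlam _ (hn k)
    rw [ih] at this
    push_cast at this ⊢
    rw [show z + 2 * lam * ((k : ℂ) + 1) = z + 2 * lam * k + 2 * lam by ring, this]
    ring
  | pred k ih =>
    have := zeta_add_lam lam hlam _ (hn (-k - 1))
    rw [show z + 2 * lam * ((-k - 1 : ℤ) : ℂ) + 2 * lam = z + 2 * lam * ((-k : ℤ) : ℂ) by
      push_cast; ring, ih] at this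
    have h2 : wzetaW lam (z + 2 * lam * ((-k - 1 : ℤ) : ℂ)) =
      wzetaW lam z + 2 * ((-k : ℤ) : ℂ) * wzetaW lam lam - 2 * wzetaW lam lam := by
      linear_combination -this
    rw [h2]
    push_cast
    ring

lemma eta_re (lam : ℝ) (hlam : 0 < lam) : (wzetaW lam Complex.I).re = 0 := by
  have h1 := zeta_conj lam hlam _ (I_not_latt lam)
  rw [Complex.conj_I, zeta_neg lam hlam _ (I_not_latt lam)] at h1
  have := congrArg Complex.re h1
  simp at this
  linarith

lemma zeta_differentiableAt (lam : ℝ) (hlam : 0 < lam) (z : ℂ) (hz : z ∉ latt lam) :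
    AnalyticAt ℂ (wzetaW lam) z := by
  have h1 : AnalyticAt ℂ (wsigma lam) z := (wsigma_differentiable lam hlam).analyticAt z
  exact h1.deriv.fun_div h1 ((wsigma_ne lam hlam z).2 hz)

lemma WzP_im (lam γ β : ℝ) (hlam : 0 < lam) (z : ℂ)
    (h : (wzetaW lam (z - Complex.I * β) - wzetaW lam (z + Complex.I * β)).re = 0) :
    (WzP lam γ β z).im = 0 := by
  have hη := eta_re lam hlam
  unfold WzP
  set X := wzetaW lam (z - Complex.I * β) - wzetaW lam (z + Complex.I * β)
  set η := wzetaW lam Complex.I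
  have h1 : (γ : ℂ) / (2 * (Real.pi : ℂ) * Complex.I) = ((γ / (2 * Real.pi) : ℝ) : ℂ) * (-Complex.I) := by
    have : (Real.pi : ℂ) ≠ 0 := by exact_mod_cast Real.pi_ne_zero
    push_cast
    field_simp
    simp
  rw [h1]
  have h2 : (2 * (β : ℂ) * η).re = 0 := by
    simp [hη]
  generalize 2 * (β : ℂ) * η = Y at *
  generalize (γ / (2 * Real.pi) : ℝ) = c at *
  simp [h, h2]

lemma wzeta_meromorphic (lam : ℝ) (hlam : 0 < lam) (c z : ℂ) :
    MeromorphicAt (fun z => wzetaW lam (z + c)) z := by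
  have h1 : ∀ w, AnalyticAt ℂ (wsigma lam) w := (wsigma_differentiable lam hlam).analyticAt
  have h2 : AnalyticAt ℂ (fun z : ℂ => z + c) z := by fun_prop
  exact ((h1 (z + c)).deriv.fun_comp (f := fun z : ℂ => z + c) h2).meromorphicAt.fun_div
    ((h1 (z + c)).fun_comp (f := fun z : ℂ => z + c) h2).meromorphicAt

lemma flux (lam γ β : ℝ) (hlam : 0 < lam) :
    ∫ t in (0 : ℝ)..1, WzP lam γ β ((lam : ℂ) + (t : ℂ) * Complex.I) * Complex.I = Complex.I := by
  set φ : ℝ → ℂ := fun s => wzetaW lam ((lam : ℂ) + (s : ℂ) * Complex.I) with hφ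
  have hnl : ∀ s : ℝ, (lam : ℂ) + (s : ℂ) * Complex.I ∉ latt lam := fun s =>
    not_latt_of_re hlam (by simp)
  have hc : Continuous φ := by
    rw [continuous_iff_continuousAt]
    intro s
    have h1 := (zeta_differentiableAt lam hlam _ (hnl s)).continuousAt
    exact ContinuousAt.comp (f := fun s : ℝ => (lam : ℂ) + (s : ℂ) * Complex.I) h1
      (by fun_prop)
  set η := wzetaW lam Complex.I with hη
  set ζl := wzetaW lam lam with hζl
  have hneg : ∀ s, φ (-s) = 2 * ζl - φ s := by
    intro s
    have hn : -((lam : ℂ) + (s : ℂ) * Complex.I) ∉ latt lam := fun h =>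
      hnl s (by simpa using latt_neg h)
    have h1 := zeta_add_lam lam hlam _ hn
    rw [zeta_neg lam hlam _ (hnl s)] at h1
    simp only [hφ]
    rw [show (lam : ℂ) + ((-s : ℝ) : ℂ) * Complex.I =
      -((lam : ℂ) + (s : ℂ) * Complex.I) + 2 * lam by push_cast; ring, h1]
    ring
  have hsh : ∀ s, φ (2 - s) = 2 * ζl + 2 * η - φ s := by
    intro s
    have h1 := zeta_add_I lam hlam _ (hnl (-s))
    have h2 := hneg s
    simp only [hφ] at h2 ⊢
    rw [show (lam : ℂ) + ((2 - s : ℝ) : ℂ) * Complex.I =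
      (lam : ℂ) + ((-s : ℝ) : ℂ) * Complex.I + 2 * Complex.I by push_cast; ring, h1, h2]
    ring
  have hint : ∀ a b, IntervalIntegrable φ MeasureTheory.volume a b := fun a b =>
    hc.intervalIntegrable a b
  have hJ1 : ∫ s in (-β)..β, φ s = 2 * β * ζl := by
    have h1 := intervalIntegral.integral_comp_neg (a := -β) (b := β) φ
    rw [neg_neg] at h1
    simp_rw [hneg] at h1
    rw [intervalIntegral.integral_sub (by simp) (hint _ _), intervalIntegral.integral_const] at h1
    simp only [Complex.real_smul] at h1
    push_cast at h1
    linear_combination (-1 / 2) * h1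
  have hJ2 : ∫ s in (1 - β)..(1 + β), φ s = 2 * β * (ζl + η) := by
    have h1 := intervalIntegral.integral_comp_sub_left (a := 1 - β) (b := 1 + β) φ 2
    rw [show (2 : ℝ) - (1 + β) = 1 - β by ring, show (2 : ℝ) - (1 - β) = 1 + β by ring] at h1
    simp_rw [hsh] at h1
    rw [intervalIntegral.integral_sub (by simp) (hint _ _), intervalIntegral.integral_const] at h1
    simp only [Complex.real_smul] at h1
    push_cast at h1
    linear_combination (-1 / 2) * h1
  have hW : ∀ t : ℝ, WzP lam γ β ((lam : ℂ) + (t : ℂ) * Complex.I) * Complex.I =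
      (γ : ℂ) / (2 * Real.pi) * (φ (t - β) - φ (t + β) + 2 * β * η) + Complex.I := by
    intro t
    have hpi : (Real.pi : ℂ) ≠ 0 := by exact_mod_cast Real.pi_ne_zero
    simp only [WzP, hφ]
    rw [show (lam : ℂ) + ((t - β : ℝ) : ℂ) * Complex.I =
      (lam : ℂ) + (t : ℂ) * Complex.I - Complex.I * β by push_cast; ring,
      show (lam : ℂ) + ((t + β : ℝ) : ℂ) * Complex.I =
      (lam : ℂ) + (t : ℂ) * Complex.I + Complex.I * β by push_cast; ring]
    have hI := Complex.I_ne_zero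
    rw [← hη]
    field_simp
  simp_rw [hW]
  have hc1 : Continuous fun t => φ (t - β) := by fun_prop
  have hc2 : Continuous fun t => φ (t + β) := by fun_prop
  have i1 := hc1.intervalIntegrable (μ := MeasureTheory.volume) 0 1
  have i2 := hc2.intervalIntegrable (μ := MeasureTheory.volume) 0 1
  rw [intervalIntegral.integral_add (by
      apply Continuous.intervalIntegrable; fun_prop) (by simp),
    intervalIntegral.integral_const_mul,
    intervalIntegral.integral_add (i1.sub i2) (by simp), intervalIntegral.integral_sub i1 i2,
    intervalIntegral.integral_comp_sub_right, intervalIntegral.integral_comp_add_right,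
    intervalIntegral.integral_const, intervalIntegral.integral_const]
  have h1 := intervalIntegral.integral_add_adjacent_intervals (hint (0 - β) β) (hint β (1 - β))
  have h2 := intervalIntegral.integral_add_adjacent_intervals (hint β (1 - β)) (hint (1 - β) (1 + β))
  rw [zero_sub] at h1
  rw [hJ1] at h1
  rw [hJ2] at h2
  rw [zero_sub, zero_add, ← h1, ← h2]
  simp only [sub_zero, one_smul]
  ring

theorem statement13 (lam γ β : ℝ) (hlam : 0 < lam) (hβ : β ∈ Ioo (0 : ℝ) 1) :
    -- (i) meromorphy and pole structure in the closed strip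
    MeromorphicOn (WzP lam γ β) Set.univ
    ∧ (∀ m : ℤ, ∃ (U : Set ℂ) (h : ℂ → ℂ), IsOpen U ∧
        (Complex.I * β + 2 * (lam : ℂ) * (m : ℂ)) ∈ U ∧ DifferentiableOn ℂ h U ∧
        ∀ z ∈ U \ {Complex.I * (β : ℂ) + 2 * (lam : ℂ) * (m : ℂ)},
          WzP lam γ β z = (γ : ℂ) / (2 * (Real.pi : ℂ) * Complex.I) *
            (z - (Complex.I * β + 2 * (lam : ℂ) * (m : ℂ)))⁻¹ + h z)
    ∧ (∀ m : ℤ, ∃ (U : Set ℂ) (h : ℂ → ℂ), IsOpen U ∧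
        (-(Complex.I * β) + 2 * (lam : ℂ) * (m : ℂ)) ∈ U ∧ DifferentiableOn ℂ h U ∧
        ∀ z ∈ U \ {-(Complex.I * (β : ℂ)) + 2 * (lam : ℂ) * (m : ℂ)},
          WzP lam γ β z = -(γ : ℂ) / (2 * (Real.pi : ℂ) * Complex.I) *
            (z - (-(Complex.I * β) + 2 * (lam : ℂ) * (m : ℂ)))⁻¹ + h z)
    ∧ (∀ z : ℂ, |z.im| ≤ 1 →
        (∀ m : ℤ, z ≠ Complex.I * β + 2 * (lam : ℂ) * (m : ℂ) ∧
          z ≠ -(Complex.I * β) + 2 * (lam : ℂ) * (m : ℂ)) →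
        AnalyticAt ℂ (WzP lam γ β) z)
    -- (ii) periodicity
    ∧ (∀ z : ℂ, z - Complex.I * β ∉ latt lam → z + Complex.I * β ∉ latt lam →
        WzP lam γ β (z + 2 * (lam : ℂ)) = WzP lam γ β z)
    -- (iii) real on the bed, the surface, and the imaginary axis away from poles
    ∧ (∀ ξ : ℝ, (WzP lam γ β (ξ : ℂ)).im = 0)
    ∧ (∀ ξ : ℝ, (WzP lam γ β ((ξ : ℂ) + Complex.I)).im = 0)
    ∧ (∀ η : ℝ, (∀ n : ℤ, η ≠ β + 2 * n ∧ η ≠ -β + 2 * n) →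
        (WzP lam γ β (Complex.I * η)).im = 0)
    -- (iv) unit flux: `Im ∫ W_ζ dζ = 1` along the segment from `λ` to `λ + i`
    ∧ (∫ t in (0 : ℝ)..1, WzP lam γ β ((lam : ℂ) + (t : ℂ) * Complex.I) * Complex.I).im = 1 := by
  have hβ0 := hβ.1
  have hβ1 := hβ.2
  set L := wPP lam hlam with hL
  have hcomp : ∀ (c z : ℂ), z + c ∉ latt lam →
      AnalyticAt ℂ (fun z => wzetaW lam (z + c)) z := fun c z h =>
    (zeta_differentiableAt lam hlam _ h).fun_comp (f := fun z : ℂ => z + c) (by fun_prop)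
  have hσc : ∀ c : ℂ, Continuous fun z => wsigma lam (z + c) := fun c =>
    (wsigma_differentiable lam hlam).continuous.comp (by fun_prop)
  have hgc : ∀ c : ℂ, Continuous fun z => wg L (z + c) := fun c =>
    (wg_differentiable L).continuous.comp (by fun_prop)
  have hlog : ∀ c z : ℂ, wg L (z + c) ≠ 0 →
      DifferentiableAt ℂ (fun z => logDeriv (wg L) (z + c)) z := by
    intro c z h
    have h1 : AnalyticAt ℂ (wg L) (z + c) := (wg_differentiable L).analyticAt _
    have h2 : AnalyticAt ℂ (logDeriv (wg L)) (z + c) := h1.deriv.fun_div h1 h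
    exact (h2.fun_comp (f := fun z => z + c) (by fun_prop)).differentiableAt
  have hkey : ∀ (w : ℂ) (m : ℤ), w ≠ 0 → wg L w ≠ 0 →
      wzetaW lam (w + 2 * lam * m) = w⁻¹ + logDeriv (wg L) w + 2 * m * wzetaW lam lam := by
    intro w m h0 hg
    have hw : w ∉ latt lam := by
      rw [← wsigma_ne lam hlam, wsigma_eq lam hlam]
      exact mul_ne_zero h0 hg
    rw [zeta_add_int lam hlam w hw m, wzetaW_eq_logDeriv lam hlam w h0 hg]
  have hg0 : wg L 0 ≠ 0 := wg_ne L 0 (.inl rfl)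
  refine ⟨?_, ?_, ?_, ?_, ?_, ?_, ?_, ?_, ?_⟩
  · intro z _
    have h1 := wzeta_meromorphic lam hlam (-(Complex.I * β)) z
    have h2 := wzeta_meromorphic lam hlam (Complex.I * β) z
    simp only [← sub_eq_add_neg] at h1
    exact (((MeromorphicAt.const _ z).fun_mul
      ((h1.fun_sub h2).fun_add (MeromorphicAt.const _ z))).fun_add (MeromorphicAt.const _ z))
  · intro m
    set p : ℂ := Complex.I * β + 2 * (lam : ℂ) * (m : ℂ) with hp
    refine ⟨{z | wg L (z + -p) ≠ 0} ∩ {z | wsigma lam (z + Complex.I * β) ≠ 0},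
      fun z => (γ : ℂ) / (2 * (Real.pi : ℂ) * Complex.I) * (logDeriv (wg L) (z + -p) +
        2 * m * wzetaW lam lam - wzetaW lam (z + Complex.I * β) +
        2 * (β : ℂ) * wzetaW lam Complex.I) + 1, ?_, ?_, ?_, ?_⟩
    · exact (isOpen_ne_fun (hgc _) continuous_const).inter
        (isOpen_ne_fun (hσc _) continuous_const)
    · refine ⟨by simpa using hg0, ?_⟩
      refine (wsigma_ne lam hlam _).2 (not_latt_of_im ?_ ?_) <;> simp [hp] <;> linarith
    · intro z hz
      have h1 := hlog _ z hz.1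
      have h2 := (hcomp _ z ((wsigma_ne lam hlam _).1 hz.2)).differentiableAt
      exact ((((h1.add_const _).fun_sub h2).add_const _).const_mul _).add_const 1
        |>.differentiableWithinAt
    · intro z hz
      have h0 : z + -p ≠ 0 := by
        rw [← sub_eq_add_neg]; exact sub_ne_zero.2 hz.2
      have h1 := hkey (z + -p) m h0 hz.1.1
      unfold WzP
      rw [show z - Complex.I * β = z + -p + 2 * lam * m by rw [hp]; ring, h1, sub_eq_add_neg z p]
      ring
  · intro m
    set p : ℂ := -(Complex.I * β) + 2 * (lam : ℂ) * (m : ℂ) with hp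
    refine ⟨{z | wg L (z + -p) ≠ 0} ∩ {z | wsigma lam (z + -(Complex.I * β)) ≠ 0},
      fun z => (γ : ℂ) / (2 * (Real.pi : ℂ) * Complex.I) * (wzetaW lam (z + -(Complex.I * β)) -
        (logDeriv (wg L) (z + -p) + 2 * m * wzetaW lam lam) +
        2 * (β : ℂ) * wzetaW lam Complex.I) + 1, ?_, ?_, ?_, ?_⟩
    · exact (isOpen_ne_fun (hgc _) continuous_const).inter
        (isOpen_ne_fun (hσc _) continuous_const)
    · refine ⟨by simpa using hg0, ?_⟩
      refine (wsigma_ne lam hlam _).2 fun h => ?_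
      refine not_latt_of_im ?_ ?_ (latt_neg h) <;> simp [hp] <;> linarith
    · intro z hz
      have h1 := hlog _ z hz.1
      have h2 := (hcomp _ z ((wsigma_ne lam hlam _).1 hz.2)).differentiableAt
      exact (((h2.fun_sub (h1.add_const _)).add_const _).const_mul _).add_const 1
        |>.differentiableWithinAt
    · intro z hz
      have h0 : z + -p ≠ 0 := by
        rw [← sub_eq_add_neg]; exact sub_ne_zero.2 hz.2
      have h1 := hkey (z + -p) m h0 hz.1.1
      unfold WzP
      rw [show z + Complex.I * β = z + -p + 2 * lam * m by rw [hp]; ring, h1, sub_eq_add_neg z p,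
        sub_eq_add_neg z (Complex.I * β)]
      ring
  · intro z hz hm
    obtain ⟨hz1, hz2⟩ := abs_le.1 hz
    have h1 : z + -(Complex.I * β) ∉ latt lam := by
      rintro ⟨a, b, hab⟩
      have him := congrArg Complex.im hab
      simp at him
      have hb1 : (-1 : ℝ) < b := by linarith
      have hb2 : (b : ℝ) < 1 := by linarith
      have hb3 : -1 < b := by exact_mod_cast hb1
      have hb4 : b < 1 := by exact_mod_cast hb2
      obtain rfl : b = 0 := by omega
      apply (hm a).1
      push_cast at hab
      linear_combination hab
    have h2 : z + Complex.I * β ∉ latt lam := by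
      rintro ⟨a, b, hab⟩
      have him := congrArg Complex.im hab
      simp at him
      have hb1 : (-1 : ℝ) < b := by linarith
      have hb2 : (b : ℝ) < 1 := by linarith
      have hb3 : -1 < b := by exact_mod_cast hb1
      have hb4 : b < 1 := by exact_mod_cast hb2
      obtain rfl : b = 0 := by omega
      apply (hm a).2
      push_cast at hab
      linear_combination hab
    have a1 := hcomp _ z h1
    have a2 := hcomp _ z h2
    simp only [← sub_eq_add_neg] at a1
    exact (analyticAt_const.fun_mul ((a1.fun_sub a2).fun_add analyticAt_const)).fun_add
      analyticAt_const
  · intro z h1 h2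
    unfold WzP
    rw [show z + 2 * (lam : ℂ) - Complex.I * β = z - Complex.I * β + 2 * lam by ring,
      show z + 2 * (lam : ℂ) + Complex.I * β = z + Complex.I * β + 2 * lam by ring,
      zeta_add_lam lam hlam _ h1, zeta_add_lam lam hlam _ h2]
    ring
  · intro ξ
    apply WzP_im lam γ β hlam
    have h1 : (ξ : ℂ) + Complex.I * β ∉ latt lam :=
      not_latt_of_im (by simpa using hβ0) (by simp; linarith)
    have h2 := zeta_conj lam hlam _ h1
    rw [show starRingEnd ℂ ((ξ : ℂ) + Complex.I * β) = ξ - Complex.I * β by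
      simp [sub_eq_add_neg]] at h2
    rw [h2]
    simp
  · intro ξ
    apply WzP_im lam γ β hlam
    have h1 : (ξ : ℂ) + Complex.I - Complex.I * β ∉ latt lam :=
      not_latt_of_im (by simpa using hβ1) (by simp; linarith)
    have h2 := zeta_conj lam hlam _ h1
    have h1' : starRingEnd ℂ ((ξ : ℂ) + Complex.I - Complex.I * β) ∉ latt lam := fun h =>
      h1 (by simpa only [Complex.conj_conj] using latt_conj h)
    have h3 := zeta_add_I lam hlam _ h1'
    rw [h2, show starRingEnd ℂ ((ξ : ℂ) + Complex.I - Complex.I * β) + 2 * Complex.I =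
      ξ + Complex.I + Complex.I * β by simp; ring] at h3
    rw [h3]
    simp [eta_re lam hlam]
  · intro η hη
    apply WzP_im lam γ β hlam
    have key : ∀ t : ℝ, (∀ n : ℤ, t ≠ 2 * n) → (wzetaW lam (Complex.I * t)).re = 0 := by
      intro t ht
      have h1 : Complex.I * (t : ℂ) ∉ latt lam := by
        intro h
        obtain ⟨m, n, -, hn⟩ := latt_cases h
        exact ht n (by simpa using hn)
      have h2 := zeta_conj lam hlam _ h1
      rw [show starRingEnd ℂ (Complex.I * (t : ℂ)) = -(Complex.I * t) by simp,
        zeta_neg lam hlam _ h1] at h2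
      have := congrArg Complex.re h2
      simp at this
      linarith
    have k1 := key (η - β) (fun n h => (hη n).1 (by linarith))
    have k2 := key (η + β) (fun n h => (hη n).2 (by linarith))
    rw [show Complex.I * (η : ℂ) - Complex.I * β = Complex.I * ((η - β : ℝ) : ℂ) by push_cast; ring,
      show Complex.I * (η : ℂ) + Complex.I * β = Complex.I * ((η + β : ℝ) : ℂ) by push_cast; ring,
      Complex.sub_re, k1, k2, sub_zero]
  · rw [flux lam γ β hlam]
    simp
end
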